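/- (Local cross-helicity balance for LAMHD-α.) Let u_s, B_s, π solve the LAMHD-α system with viscosity ν and diffusivity η. Then the cross-helicity density u·B_s satisfies, at every point, ∂_t (u·B_s) + div( (u·B_s) u_s + π B_s ) = ν B_s·Δu + η u·ΔB. In particular, when ν = η = 0 the cross-helicity density satisfies a pointwise conservation law. -/

import Mathlib

open Matrix MeasureTheory

noncomputable section

abbrev V3 := Fin 3 → ℝ

/-- Partial derivative `∂_j f` of a scalar field on ℝ³. -/
def pd (j : Fin 3) (f : V3 → ℝ) (x : V3) : ℝ := fderiv ℝ f x (Pi.single j 1)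

/-- Jacobian matrix field: `(∇f)_{ij} = ∂f_i/∂x_j`. -/
def grad (f : V3 → V3) (x : V3) : Matrix (Fin 3) (Fin 3) ℝ :=
  Matrix.of fun i j => pd j (fun y => f y i) x

/-- Divergence of a vector field. -/
def divV (f : V3 → V3) (x : V3) : ℝ := ∑ j, pd j (fun y => f y j) x

/-- Divergence of a matrix field: `(div M)_i = Σ_j ∂_j M_{ij}`. -/
def divM (M : V3 → Matrix (Fin 3) (Fin 3) ℝ) (x : V3) (i : Fin 3) : ℝ :=
  ∑ j, pd j (fun y => M y i j) x

/-- Scalar Laplacian. -/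
def lapS (φ : V3 → ℝ) (x : V3) : ℝ := ∑ j, pd j (fun y => pd j φ y) x

/-- Componentwise Laplacian of a vector field. -/
def lap (f : V3 → V3) (x : V3) (i : Fin 3) : ℝ := lapS (fun y => f y i) x

/-- Helmholtz operator `(1 - α²Δ)` on vector fields. -/
def helm (α : ℝ) (f : V3 → V3) (x : V3) (i : Fin 3) : ℝ := f x i - α ^ 2 * lap f x i

/-- Helmholtz operator `(1 - α²Δ)` on scalar fields. -/
def helmS (α : ℝ) (φ : V3 → ℝ) (x : V3) : ℝ := φ x - α ^ 2 * lapS φ x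

/-- Advection `(g·∇)f = Σ_j g_j ∂_j f`. -/
def advect (g f : V3 → V3) (x : V3) (i : Fin 3) : ℝ :=
  ∑ j, g x j * pd j (fun y => f y i) x

/-- `(∇f)ᵀ·g`, pointwise matrix-vector product. -/
def gradTvec (f g : V3 → V3) (x : V3) (i : Fin 3) : ℝ :=
  ∑ j, (grad f x)ᵀ i j * g x j

/-- Gradient of a scalar field. -/
def gradS (φ : V3 → ℝ) (x : V3) (i : Fin 3) : ℝ := pd i φ x

/-- Pointwise squared Euclidean norm `|f|²`. -/
def normSq (f : V3 → V3) (x : V3) : ℝ := ∑ i, (f x i) ^ 2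

/-- Squared Frobenius norm of the Jacobian, `|∇f|²`. -/
def gradNormSq (f : V3 → V3) (x : V3) : ℝ := ∑ i, ∑ j, (grad f x i j) ^ 2

/-- Spatial tslice at time `t` of a time-dependent vector field. -/
def tslice (f : ℝ × V3 → V3) (t : ℝ) : V3 → V3 := fun x => f (t, x)

section PartialDerivatives

variable {j : Fin 3} {f g : V3 → ℝ} {x : V3}

theorem pd_add (hf : DifferentiableAt ℝ f x) (hg : DifferentiableAt ℝ g x) :
    pd j (fun y => f y + g y) x = pd j f x + pd j g x := by
  simp [pd, fderiv_fun_add hf hg]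

theorem pd_mul (hf : DifferentiableAt ℝ f x) (hg : DifferentiableAt ℝ g x) :
    pd j (fun y => f y * g y) x = f x * pd j g x + pd j f x * g x := by
  simp [pd, fderiv_fun_mul hf hg, mul_comm]

theorem pd_sum {ι : Type*} {s : Finset ι} {F : ι → V3 → ℝ}
    (hF : ∀ i ∈ s, DifferentiableAt ℝ (F i) x) :
    pd j (fun y => ∑ i ∈ s, F i y) x = ∑ i ∈ s, pd j (F i) x := by
  simp [pd, fderiv_fun_sum hF]

end PartialDerivatives

theorem tslice_apply (f : ℝ × V3 → V3) (t : ℝ) (x : V3) : tslice f t x = f (t, x) := rfl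

/-- Spatial partial derivatives of a field smooth in space-time are smooth in space-time. -/
theorem contDiff_pd {f : ℝ × V3 → ℝ} (hf : ContDiff ℝ (⊤ : ℕ∞) f) (j : Fin 3) :
    ContDiff ℝ (⊤ : ℕ∞) fun p : ℝ × V3 => pd j (fun y => f (p.1, y)) p.2 := by
  have h : ContDiff ℝ (⊤ : ℕ∞)
      (Function.uncurry fun (p : ℝ × V3) (y : V3) => f (p.1, y)) :=
    hf.comp ((contDiff_fst.comp contDiff_fst).prodMk contDiff_snd)
  exact (ContDiff.fderiv h contDiff_snd (by simp)).clm_apply contDiff_const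

theorem contDiff_helm {α : ℝ} {f : ℝ × V3 → V3} (hf : ContDiff ℝ (⊤ : ℕ∞) f) (i : Fin 3) :
    ContDiff ℝ (⊤ : ℕ∞) fun p : ℝ × V3 => helm α (tslice f p.1) p.2 i := by
  have hi : ContDiff ℝ (⊤ : ℕ∞) fun p => f p i := contDiff_pi.1 hf i
  have hlap : ContDiff ℝ (⊤ : ℕ∞) fun p : ℝ × V3 => lap (tslice f p.1) p.2 i := by
    unfold lap lapS
    exact ContDiff.sum fun j _ => contDiff_pd (contDiff_pd hi j) j
  exact hi.sub (contDiff_const.mul hlap)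

section Slices

variable {f : ℝ × V3 → ℝ}

theorem differentiableAt_space (hf : ContDiff ℝ (⊤ : ℕ∞) f) (t : ℝ) (x : V3) :
    DifferentiableAt ℝ (fun y => f (t, y)) x :=
  (hf.comp (contDiff_const.prodMk contDiff_id)).differentiable (by simp) x

theorem differentiableAt_time (hf : ContDiff ℝ (⊤ : ℕ∞) f) (t : ℝ) (x : V3) :
    DifferentiableAt ℝ (fun s => f (s, x)) t :=
  (hf.comp (contDiff_id.prodMk contDiff_const)).differentiable (by simp) t

end Slices

/-- local cross-helicity balance for LAMHD-α:
`∂_t(u·B_s) + div((u·B_s)u_s + π B_s) = ν B_s·Δu + η u·ΔB`, and in the ideal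
case `ν = η = 0` the cross-helicity density satisfies a pointwise conservation law. -/
theorem lamhd_cross_helicity_balance (α : ℝ) (hα : 0 ≤ α) (ν η : ℝ)
    (us Bs : ℝ × V3 → V3) (pres : ℝ × V3 → ℝ)
    (hus : ContDiff ℝ (⊤ : ℕ∞) us) (hBs : ContDiff ℝ (⊤ : ℕ∞) Bs) (hpres : ContDiff ℝ (⊤ : ℕ∞) pres)
    (hdivu : ∀ t : ℝ, ∀ x : V3, divV (tslice us t) x = 0)
    (hdivB : ∀ t : ℝ, ∀ x : V3, divV (tslice Bs t) x = 0)
    (hmotion : ∀ t : ℝ, ∀ x : V3, ∀ i : Fin 3,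
      deriv (fun s => helm α (tslice us s) x i) t
        + advect (tslice us t) (helm α (tslice us t)) x i
        - advect (tslice Bs t) (helm α (tslice Bs t)) x i
        + gradTvec (tslice us t) (helm α (tslice us t)) x i
        + gradTvec (helm α (tslice Bs t)) (tslice Bs t) x i
        + gradS (fun y => pres (t, y)) x i
        = ν * lap (helm α (tslice us t)) x i)
    (hinduction : ∀ t : ℝ, ∀ x : V3, ∀ i : Fin 3,
      deriv (fun s => Bs (s, x) i) t
        + advect (tslice us t) (tslice Bs t) x i
        - advect (tslice Bs t) (tslice us t) x i
        = η * lap (helm α (tslice Bs t)) x i) :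
    (∀ t : ℝ, ∀ x : V3,
      deriv (fun s => ∑ i, helm α (tslice us s) x i * Bs (s, x) i) t
        + divV (fun y j =>
            (∑ i, helm α (tslice us t) y i * Bs (t, y) i) * us (t, y) j
            + pres (t, y) * Bs (t, y) j) x
      = ν * (∑ i, Bs (t, x) i * lap (helm α (tslice us t)) x i)
        + η * (∑ i, helm α (tslice us t) x i * lap (helm α (tslice Bs t)) x i)) ∧
    (ν = 0 → η = 0 → ∀ t : ℝ, ∀ x : V3,
      deriv (fun s => ∑ i, helm α (tslice us s) x i * Bs (s, x) i) t
        + divV (fun y j =>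
            (∑ i, helm α (tslice us t) y i * Bs (t, y) i) * us (t, y) j
            + pres (t, y) * Bs (t, y) j) x = 0) := by
  have balance : ∀ t : ℝ, ∀ x : V3,
      deriv (fun s => ∑ i, helm α (tslice us s) x i * Bs (s, x) i) t
        + divV (fun y j =>
            (∑ i, helm α (tslice us t) y i * Bs (t, y) i) * us (t, y) j
            + pres (t, y) * Bs (t, y) j) x
      = ν * (∑ i, Bs (t, x) i * lap (helm α (tslice us t)) x i)
        + η * (∑ i, helm α (tslice us t) x i * lap (helm α (tslice Bs t)) x i) := by
    intro t x
    have hu : ∀ i, DifferentiableAt ℝ (fun y => helm α (tslice us t) y i) x := fun i =>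
      differentiableAt_space (contDiff_helm (α := α) hus i) t x
    have hut : ∀ i, DifferentiableAt ℝ (fun s => helm α (tslice us s) x i) t := fun i =>
      differentiableAt_time (contDiff_helm (α := α) hus i) t x
    have hv := fun i => differentiableAt_space (contDiff_pi.1 hus i) t x
    have hb := fun i => differentiableAt_space (contDiff_pi.1 hBs i) t x
    have hbt := fun i => differentiableAt_time (contDiff_pi.1 hBs i) t x
    have hp := differentiableAt_space hpres t x
    have time_deriv : deriv (fun s => ∑ i, helm α (tslice us s) x i * Bs (s, x) i) t
        = ∑ i, (deriv (fun s => helm α (tslice us s) x i) t * Bs (t, x) i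
          + helm α (tslice us t) x i * deriv (fun s => Bs (s, x) i) t) := by
      rw [deriv_fun_sum fun i _ => (hut i).fun_mul (hbt i)]
      exact Finset.sum_congr rfl fun i _ => deriv_fun_mul (hut i) (hbt i)
    have density_pd : ∀ j, pd j (fun y => ∑ i, helm α (tslice us t) y i * Bs (t, y) i) x
        = ∑ i, (helm α (tslice us t) x i * pd j (fun y => Bs (t, y) i) x
          + pd j (fun y => helm α (tslice us t) y i) x * Bs (t, x) i) := fun j => by
      rw [pd_sum fun i _ => (hu i).fun_mul (hb i)]
      exact Finset.sum_congr rfl fun i _ => pd_mul (hu i) (hb i)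
    have hd : DifferentiableAt ℝ (fun y => ∑ i, helm α (tslice us t) y i * Bs (t, y) i) x :=
      DifferentiableAt.fun_sum fun i _ => (hu i).fun_mul (hb i)
    have flux_pd : ∀ j, pd j (fun y =>
          (∑ i, helm α (tslice us t) y i * Bs (t, y) i) * us (t, y) j
          + pres (t, y) * Bs (t, y) j) x
        = (∑ i, helm α (tslice us t) x i * Bs (t, x) i) * pd j (fun y => us (t, y) j) x
          + (∑ i, (helm α (tslice us t) x i * pd j (fun y => Bs (t, y) i) x
            + pd j (fun y => helm α (tslice us t) y i) x * Bs (t, x) i)) * us (t, x) j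
          + (pres (t, x) * pd j (fun y => Bs (t, y) j) x
            + pd j (fun y => pres (t, y)) x * Bs (t, x) j) := fun j => by
      rw [pd_add (hd.fun_mul (hv j)) (hp.fun_mul (hb j)), pd_mul hd (hv j), pd_mul hp (hb j),
        density_pd]
    have hm := hmotion t x
    have hi := hinduction t x
    have hdu := hdivu t x
    have hdB := hdivB t x
    rw [time_deriv]
    simp only [divV, flux_pd]
    simp only [tslice_apply, divV, advect, gradTvec, grad, gradS, transpose_apply, of_apply,
      Fin.sum_univ_three] at hm hi hdu hdB ⊢
    linear_combination Bs (t, x) 0 * hm 0 + Bs (t, x) 1 * hm 1 + Bs (t, x) 2 * hm 2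
      + helm α (tslice us t) x 0 * hi 0 + helm α (tslice us t) x 1 * hi 1
      + helm α (tslice us t) x 2 * hi 2
      + (helm α (tslice us t) x 0 * Bs (t, x) 0 + helm α (tslice us t) x 1 * Bs (t, x) 1
        + helm α (tslice us t) x 2 * Bs (t, x) 2) * hdu
      + pres (t, x) * hdB
  refine ⟨balance, fun hν hη t x => ?_⟩
  rw [balance, hν, hη]
  ring
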